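/- arXiv:1802.05221 — 2 statements merged into one kernel-verified Lean document; each statement's English description precedes it below -/
import Mathlib

section
/- Fix an integer d ≥ 1 and real parameters α, β, k with k > 0, k < β + 1 and α + β − k > 0. For a real parameter t, write X_n^{(t)}, Y_n^{(t)}, R_n^{(t)}, S_n^{(t)}, A_n^{(t)}, B_n^{(t)}, C_n^{(t)} for the matrices of the context with α replaced by t. Then one has the LU block factorization identities with the parameter α shifted by one: A_n^{(α)} = S_n^{(α+1)} X_n^{(α+1)} for all n ≥ 0; B_0^{(α)} = S_0^{(α+1)} Y_0^{(α+1)}; B_n^{(α)} = R_n^{(α+1)} X_{n−1}^{(α+1)} + S_n^{(α+1)} Y_n^{(α+1)} for all n ≥ 1; and C_n^{(α)} = R_n^{(α+1)} Y_{n−1}^{(α+1)} for all n ≥ 1. -/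
noncomputable def a1 (d : ℕ) (α β k : ℝ) (i n : ℕ) : ℝ :=
  (((n : ℝ) + k) * ((n : ℝ) + β + (d : ℝ))) /
    ((2 * (n : ℝ) + α + β + (d : ℝ) + (i : ℝ)) *
      ((n : ℝ) + k + (d : ℝ) - (i : ℝ) - 1))

noncomputable def a2 (d : ℕ) (α β k : ℝ) (i n : ℕ) : ℝ :=
  (((d : ℝ) - (i : ℝ) - 1) * (β - k + (i : ℝ) + 1)) /
    (((n : ℝ) + α + β - k + 2 * (i : ℝ) + 1) *
      ((n : ℝ) + k + (d : ℝ) - (i : ℝ) - 1))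

noncomputable def a3 (d : ℕ) (α β k : ℝ) (i n : ℕ) : ℝ :=
  (((n : ℝ) + α + (i : ℝ)) * ((n : ℝ) + α + β - k + (d : ℝ) + (i : ℝ))) /
    ((2 * (n : ℝ) + α + β + (d : ℝ) + (i : ℝ)) *
      ((n : ℝ) + α + β - k + 2 * (i : ℝ) + 1))

noncomputable def b1 (d : ℕ) (α β k : ℝ) (i n : ℕ) : ℝ :=
  ((n : ℝ) * ((n : ℝ) + k + (d : ℝ) - 1)) /
    ((2 * (n : ℝ) + α + β + (d : ℝ) + (i : ℝ) - 1) *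
      ((n : ℝ) + k + (d : ℝ) - (i : ℝ) - 1))

noncomputable def b2 (d : ℕ) (α β k : ℝ) (i n : ℕ) : ℝ :=
  ((i : ℝ) * (k + (d : ℝ) - (i : ℝ) - 1)) /
    (((n : ℝ) + α + β - k + 2 * (i : ℝ)) *
      ((n : ℝ) + k + (d : ℝ) - (i : ℝ) - 1))

noncomputable def b3 (d : ℕ) (α β k : ℝ) (i n : ℕ) : ℝ :=
  (((n : ℝ) + α + β + (d : ℝ) + (i : ℝ) - 1) * ((n : ℝ) + α + β - k + (i : ℝ))) /
    ((2 * (n : ℝ) + α + β + (d : ℝ) + (i : ℝ) - 1) *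
      ((n : ℝ) + α + β - k + 2 * (i : ℝ)))

/-- `X n = Σ_{i=0}^{d-1} a₁(i,n) E_{ii}`. -/
noncomputable def Xm (d : ℕ) (α β k : ℝ) (n : ℕ) : Matrix (Fin d) (Fin d) ℝ :=
  Matrix.of fun i j : Fin d =>
    if (i : ℕ) = (j : ℕ) then a1 d α β k i n else 0

/-- `Y n = Σ_{i=0}^{d-1} a₃(i,n) E_{ii} + Σ_{i=0}^{d-2} a₂(i,n) E_{i,i+1}`. -/
noncomputable def Ym (d : ℕ) (α β k : ℝ) (n : ℕ) : Matrix (Fin d) (Fin d) ℝ :=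
  Matrix.of fun i j : Fin d =>
    if (i : ℕ) = (j : ℕ) then a3 d α β k i n
    else if (j : ℕ) = (i : ℕ) + 1 then a2 d α β k i n else 0

/-- `R n = Σ_{i=0}^{d-1} b₁(i,n) E_{ii}`. -/
noncomputable def Rm (d : ℕ) (α β k : ℝ) (n : ℕ) : Matrix (Fin d) (Fin d) ℝ :=
  Matrix.of fun i j : Fin d =>
    if (i : ℕ) = (j : ℕ) then b1 d α β k i n else 0

/-- `S n = Σ_{i=0}^{d-1} b₃(i,n) E_{ii} + Σ_{i=0}^{d-2} b₂(i+1,n) E_{i+1,i}`. -/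
noncomputable def Sm (d : ℕ) (α β k : ℝ) (n : ℕ) : Matrix (Fin d) (Fin d) ℝ :=
  Matrix.of fun i j : Fin d =>
    if (i : ℕ) = (j : ℕ) then b3 d α β k i n
    else if (i : ℕ) = (j : ℕ) + 1 then b2 d α β k i n else 0

/-- `A n = Σ_{i=0}^{d-1} a₁(i,n)b₃(i,n+1) E_{ii}
          + Σ_{i=0}^{d-2} a₁(i+1,n)b₂(i+1,n+1) E_{i+1,i}`. -/
noncomputable def Am (d : ℕ) (α β k : ℝ) (n : ℕ) : Matrix (Fin d) (Fin d) ℝ :=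
  Matrix.of fun i j : Fin d =>
    if (i : ℕ) = (j : ℕ) then a1 d α β k i n * b3 d α β k i (n + 1)
    else if (i : ℕ) = (j : ℕ) + 1 then a1 d α β k i n * b2 d α β k i (n + 1)
    else 0

/-- `B n = Σ_{i=0}^{d-2} a₃(i+1,n)b₂(i+1,n) E_{i+1,i}
          + Σ_{i=0}^{d-2} a₂(i,n)b₃(i+1,n) E_{i,i+1}
          + Σ_{i=0}^{d-1} [a₁(i,n)b₁(i,n+1) + a₂(i,n)b₂(i+1,n)
                            + a₃(i,n)b₃(i,n)] E_{ii}`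
(here `a₂(d-1,n)b₂(d,n) = 0` automatically since `a₂(d-1,n) = 0`). -/
noncomputable def Bm (d : ℕ) (α β k : ℝ) (n : ℕ) : Matrix (Fin d) (Fin d) ℝ :=
  Matrix.of fun i j : Fin d =>
    if (i : ℕ) = (j : ℕ) then
      a1 d α β k i n * b1 d α β k i (n + 1) +
        a2 d α β k i n * b2 d α β k ((i : ℕ) + 1) n +
        a3 d α β k i n * b3 d α β k i n
    else if (i : ℕ) = (j : ℕ) + 1 then a3 d α β k i n * b2 d α β k i n
    else if (j : ℕ) = (i : ℕ) + 1 then a2 d α β k i n * b3 d α β k ((i : ℕ) + 1) n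
    else 0

/-- `C n = Σ_{i=0}^{d-1} a₃(i,n)b₁(i,n) E_{ii}
          + Σ_{i=0}^{d-2} a₂(i,n)b₁(i+1,n) E_{i,i+1}`. -/
noncomputable def Cm (d : ℕ) (α β k : ℝ) (n : ℕ) : Matrix (Fin d) (Fin d) ℝ :=
  Matrix.of fun i j : Fin d =>
    if (i : ℕ) = (j : ℕ) then a3 d α β k i n * b1 d α β k i n
    else if (j : ℕ) = (i : ℕ) + 1 then a2 d α β k i n * b1 d α β k ((i : ℕ) + 1) n
    else 0

/-- Left multiplication by `Sm` acts on rows as a lower bidiagonal operator; at `i = 0` the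
second term vanishes because `b2` does. -/
theorem Sm_mul_apply (d : ℕ) (α β k : ℝ) (n : ℕ) (f : ℕ → ℕ → ℝ) (i j : Fin d) :
    (Sm d α β k n * Matrix.of fun l m : Fin d => f l m) i j =
      b3 d α β k i n * f i j + b2 d α β k i n * f (i - 1) j := by
  obtain ⟨i, hi⟩ := i
  simp only [Matrix.mul_apply, Sm, Matrix.of_apply]
  cases i with
  | zero =>
    rw [Finset.sum_eq_single ⟨0, hi⟩]
    · simp [b2]
    · rintro ⟨l, hl⟩ - h
      have h0 : 0 ≠ l := fun h' => h (by simp [← h'])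
      simp [h0]
    · simp
  | succ i =>
    have hi' : i < d := by omega
    rw [← Finset.sum_subset (Finset.subset_univ {⟨i + 1, hi⟩, ⟨i, hi'⟩}),
      Finset.sum_pair (by simp)]
    · simp
    · rintro ⟨l, hl⟩ - h
      simp only [Finset.mem_insert, Finset.mem_singleton, Fin.mk.injEq, not_or] at h
      have h1 : i + 1 ≠ l := fun h' => h.1 h'.symm
      have h2 : i + 1 ≠ l + 1 := fun h' => h.2 (by omega)
      simp only [h1, h2, if_false, zero_mul]

theorem Rm_mul_apply (d : ℕ) (α β k : ℝ) (n : ℕ) (M : Matrix (Fin d) (Fin d) ℝ)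
    (i j : Fin d) : (Rm d α β k n * M) i j = b1 d α β k i n * M i j := by
  simp [Matrix.mul_apply, Rm, ← Fin.ext_iff]

theorem Sm_mul_Xm_apply (d : ℕ) (α β k : ℝ) (n : ℕ) (i j : Fin d) :
    (Sm d α β k n * Xm d α β k n) i j =
      b3 d α β k i n * (if (i : ℕ) = j then a1 d α β k i n else 0) +
        b2 d α β k i n * (if (i : ℕ) - 1 = j then a1 d α β k (i - 1) n else 0) :=
  Sm_mul_apply d α β k n (fun l m => if l = m then a1 d α β k l n else 0) i j

theorem Sm_mul_Ym_apply (d : ℕ) (α β k : ℝ) (n : ℕ) (i j : Fin d) :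
    (Sm d α β k n * Ym d α β k n) i j =
      b3 d α β k i n * (if (i : ℕ) = j then a3 d α β k i n
        else if (j : ℕ) = i + 1 then a2 d α β k i n else 0) +
      b2 d α β k i n * (if (i : ℕ) - 1 = j then a3 d α β k (i - 1) n
        else if (j : ℕ) = i - 1 + 1 then a2 d α β k (i - 1) n else 0) :=
  Sm_mul_apply d α β k n (fun l m => if l = m then a3 d α β k l n
    else if m = l + 1 then a2 d α β k l n else 0) i j

theorem b2_zero (d : ℕ) (α β k : ℝ) (n : ℕ) : b2 d α β k 0 n = 0 := by
  simp [b2]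

theorem a1_mul_b3 (d : ℕ) (α β k : ℝ) (i n : ℕ) :
    a1 d α β k i n * b3 d α β k i (n + 1) =
      b3 d (α + 1) β k i n * a1 d (α + 1) β k i n := by
  simp only [a1, b3]
  push_cast
  rw [div_mul_div_comm, div_mul_div_comm]
  congr 1 <;> ring

theorem a1_mul_b2_succ (d : ℕ) (α β k : ℝ) (i n : ℕ) :
    a1 d α β k (i + 1) n * b2 d α β k (i + 1) (n + 1) =
      b2 d (α + 1) β k (i + 1) n * a1 d (α + 1) β k i n := by
  simp only [a1, b2]
  push_cast
  rw [div_mul_div_comm, div_mul_div_comm]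
  congr 1 <;> ring

theorem a3_mul_b2_succ (d : ℕ) (α β k : ℝ) (i n : ℕ) :
    a3 d α β k (i + 1) n * b2 d α β k (i + 1) n =
      b2 d (α + 1) β k (i + 1) n * a3 d (α + 1) β k i n := by
  simp only [a3, b2]
  push_cast
  rw [div_mul_div_comm, div_mul_div_comm]
  congr 1 <;> ring

theorem a2_mul_b3_succ (d : ℕ) (α β k : ℝ) (i n : ℕ) :
    a2 d α β k i n * b3 d α β k (i + 1) n =
      b3 d (α + 1) β k i n * a2 d (α + 1) β k i n := by
  simp only [a2, b3]
  push_cast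
  rw [div_mul_div_comm, div_mul_div_comm]
  congr 1 <;> ring

theorem a3_mul_b1 (d : ℕ) (α β k : ℝ) (i n : ℕ) :
    a3 d α β k i (n + 1) * b1 d α β k i (n + 1) =
      b1 d (α + 1) β k i (n + 1) * a3 d (α + 1) β k i n := by
  simp only [a3, b1]
  push_cast
  rw [div_mul_div_comm, div_mul_div_comm]
  congr 1 <;> ring

theorem a2_mul_b1_succ (d : ℕ) (α β k : ℝ) (i n : ℕ) :
    a2 d α β k i (n + 1) * b1 d α β k (i + 1) (n + 1) =
      b1 d (α + 1) β k i (n + 1) * a2 d (α + 1) β k i n := by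
  simp only [a2, b1]
  push_cast
  rw [div_mul_div_comm, div_mul_div_comm]
  congr 1 <;> ring

/-- The off-diagonal entries of `Bm` always match those of the product `Sm * Ym`, so the
entries of `Bm` are determined by a decomposition of its diagonal. -/
theorem Bm_apply_of_diagonal {d : ℕ} (α β k : ℝ) (n : ℕ) (i j : Fin d) (c : ℝ)
    (h : a1 d α β k i n * b1 d α β k i (n + 1) +
        a2 d α β k i n * b2 d α β k (i + 1) n +
        a3 d α β k i n * b3 d α β k i n =
      c + (b3 d (α + 1) β k i n * a3 d (α + 1) β k i n +
        b2 d (α + 1) β k i n * a2 d (α + 1) β k (i - 1) n)) :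
    Bm d α β k n i j = (if (i : ℕ) = j then c else 0) +
      (b3 d (α + 1) β k i n * (if (i : ℕ) = j then a3 d (α + 1) β k i n
        else if (j : ℕ) = i + 1 then a2 d (α + 1) β k i n else 0) +
      b2 d (α + 1) β k i n * (if (i : ℕ) - 1 = j then a3 d (α + 1) β k (i - 1) n
        else if (j : ℕ) = i - 1 + 1 then a2 d (α + 1) β k (i - 1) n else 0)) := by
  obtain ⟨i, hi⟩ := i
  obtain ⟨j, hj⟩ := j
  simp only [Bm, Matrix.of_apply] at h ⊢
  by_cases hij : i = j
  · subst hij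
    rw [if_pos rfl, h]
    rcases i with _ | i <;> simp [b2_zero]
  · rcases i with _ | i
    · by_cases hj1 : j = 1 <;> simp [hij, hj1, b2_zero, a2_mul_b3_succ]
    · by_cases hji : i = j
      · subst hji
        have h2 : i ≠ i + 1 + 1 := by omega
        simp [a3_mul_b2_succ, h2]
      · by_cases hj2 : j = i + 1 + 1
        · subst hj2
          simp [a2_mul_b3_succ, hji]
        · have hj1 : j ≠ i + 1 := fun h => hij h.symm
          simp [hij, hji, hj1, hj2]

/-- The diagonal identity as a rational function identity, in the coordinates
`p = n + k + d - i - 1` and `q = n + α + β - k + 2 * i`. -/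
theorem diagonal_rational_identity {n k d i p q : ℝ} (hp : p = n + k + d - i - 1) (β : ℝ)
    (p0 : p ≠ 0) (p1 : p + 1 ≠ 0) (p2 : p - 1 ≠ 0)
    (q0 : q ≠ 0) (q1 : q + 1 ≠ 0) (q2 : q + 2 ≠ 0)
    (s0 : p + q ≠ 0) (s1 : p + q + 1 ≠ 0) (s2 : p + q + 2 ≠ 0) :
    (n + k) * (n + β + d) / ((p + q + 1) * p) *
        ((n + 1) * (n + k + d) / ((p + q + 2) * (p + 1))) +
      (d - i - 1) * (β - k + i + 1) / ((q + 1) * p) *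
        ((i + 1) * (k + d - i - 2) / ((q + 2) * (p - 1))) +
      (q + k - β - i) * (q + d - i) / ((p + q + 1) * (q + 1)) *
        ((p + q - n) * (q - i) / ((p + q) * q)) =
    n * (n + k + d - 1) / ((p + q + 1) * p) *
        ((n - 1 + k) * (n - 1 + β + d) / ((p + q) * (p - 1))) +
      ((p + q + 1 - n) * (q + 1 - i) / ((p + q + 1) * (q + 1)) *
        ((q + 1 + k - β - i) * (q + 1 + d - i) / ((p + q + 2) * (q + 2))) +
      i * (k + d - i - 1) / ((q + 1) * p) *
        ((d - i) * (β - k + i) / (q * (p + 1)))) := by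
  obtain rfl : d = p - n - k + i + 1 := by linarith
  field_simp
  ring

/-- The case `n = 0`, `i = d - 1` of `diagonal_rational_identity`, where `p = k` and the terms
with denominator `p - 1` are absent. -/
theorem diagonal_rational_identity_corner {k i q : ℝ} (β : ℝ)
    (p0 : k ≠ 0) (p1 : k + 1 ≠ 0) (q0 : q ≠ 0) (q1 : q + 1 ≠ 0) (q2 : q + 2 ≠ 0)
    (s0 : k + q ≠ 0) (s1 : k + q + 1 ≠ 0) (s2 : k + q + 2 ≠ 0) :
    k * (β + (i + 1)) / ((k + q + 1) * k) *
        ((k + (i + 1)) / ((k + q + 2) * (k + 1))) +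
      (q + k - β - i) * (q + 1) / ((k + q + 1) * (q + 1)) *
        ((k + q) * (q - i) / ((k + q) * q)) =
    (k + q + 1) * (q + 1 - i) / ((k + q + 1) * (q + 1)) *
        ((q + 1 + k - β - i) * (q + 2) / ((k + q + 2) * (q + 2))) +
      i * k / ((q + 1) * k) * ((β - k + i) / (q * (k + 1))) := by
  field_simp
  ring

theorem div_mul_div_congr {a b c e a' b' c' e' : ℝ} (ha : a = a') (hb : b = b')
    (hc : c = c') (he : e = e') : a / b * (c / e) = a' / b' * (c' / e') := by
  rw [ha, hb, hc, he]

section DiagonalEntries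

variable {d : ℕ} {α β k : ℝ} {i : ℕ}

theorem b2_mul_a2_pred (d : ℕ) (α β k : ℝ) (i n : ℕ) :
    b2 d α β k i n * a2 d α β k (i - 1) n =
      (i : ℝ) * (k + d - i - 1) / ((n + α + β - k + 2 * i) * (n + k + d - i - 1)) *
        ((d - i) * (β - k + i) / ((n + α + β - k + 2 * i - 1) * (n + k + d - i))) := by
  cases i with
  | zero => simp [b2]
  | succ i =>
    simp only [a2, b2, Nat.add_sub_cancel]
    push_cast
    apply div_mul_div_congr <;> ring

theorem diagonal_entry (hk : 0 < k) (hαβk : 0 < α + β - k) (hi : i < d) (n : ℕ)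
    (hp : (n : ℝ) + k + d - i - 1 - 1 ≠ 0) :
    a1 d α β k i n * b1 d α β k i (n + 1) +
        a2 d α β k i n * b2 d α β k (i + 1) n +
        a3 d α β k i n * b3 d α β k i n =
      b1 d (α + 1) β k i n * (((n : ℝ) - 1 + k) * (n - 1 + β + d) /
          ((2 * n + α + β + d + i - 1) * (n + k + d - i - 2))) +
        (b3 d (α + 1) β k i n * a3 d (α + 1) β k i n +
          b2 d (α + 1) β k i n * a2 d (α + 1) β k (i - 1) n) := by
  have hid : (i : ℝ) + 1 ≤ d := by exact_mod_cast hi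
  have hi0 : (0 : ℝ) ≤ i := i.cast_nonneg
  have hn0 : (0 : ℝ) ≤ n := n.cast_nonneg
  have key := diagonal_rational_identity (n := n) (k := k) (d := d) (i := i)
    (p := n + k + d - i - 1) (q := n + α + β - k + 2 * i) rfl β
    (ne_of_gt (by linarith)) (ne_of_gt (by linarith)) hp
    (ne_of_gt (by linarith)) (ne_of_gt (by linarith)) (ne_of_gt (by linarith))
    (ne_of_gt (by linarith)) (ne_of_gt (by linarith)) (ne_of_gt (by linarith))
  rw [b2_mul_a2_pred]
  simp only [a1, a2, a3, b1, b2, b3]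
  push_cast
  refine Eq.trans ?_ (key.trans ?_)
  · refine congrArg₂ (· + ·) (congrArg₂ (· + ·) ?_ ?_) ?_ <;>
      apply div_mul_div_congr <;> ring
  · refine congrArg₂ (· + ·) ?_ (congrArg₂ (· + ·) ?_ ?_) <;>
      apply div_mul_div_congr <;> ring

theorem diagonal_entry_succ (hk : 0 < k) (hαβk : 0 < α + β - k) (hi : i < d) (n : ℕ) :
    a1 d α β k i (n + 1) * b1 d α β k i (n + 1 + 1) +
        a2 d α β k i (n + 1) * b2 d α β k (i + 1) (n + 1) +
        a3 d α β k i (n + 1) * b3 d α β k i (n + 1) =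
      b1 d (α + 1) β k i (n + 1) * a1 d (α + 1) β k i n +
        (b3 d (α + 1) β k i (n + 1) * a3 d (α + 1) β k i (n + 1) +
          b2 d (α + 1) β k i (n + 1) * a2 d (α + 1) β k (i - 1) (n + 1)) := by
  have hid : (i : ℝ) + 1 ≤ d := by exact_mod_cast hi
  have hn0 : (0 : ℝ) ≤ n := n.cast_nonneg
  rw [diagonal_entry hk hαβk hi (n + 1) (ne_of_gt (by push_cast; linarith))]
  refine congrArg₂ (· + ·) ?_ rfl
  simp only [a1, b1]
  push_cast
  apply div_mul_div_congr <;> ring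

theorem diagonal_entry_zero (hk : 0 < k) (hαβk : 0 < α + β - k) (hi : i < d) :
    a1 d α β k i 0 * b1 d α β k i (0 + 1) +
        a2 d α β k i 0 * b2 d α β k (i + 1) 0 +
        a3 d α β k i 0 * b3 d α β k i 0 =
      b3 d (α + 1) β k i 0 * a3 d (α + 1) β k i 0 +
        b2 d (α + 1) β k i 0 * a2 d (α + 1) β k (i - 1) 0 := by
  have hi0 : (0 : ℝ) ≤ i := i.cast_nonneg
  rcases Nat.lt_or_eq_of_le (Nat.succ_le_of_lt hi) with hid | rfl
  · have hid' : (i : ℝ) + 1 + 1 ≤ d := by exact_mod_cast hid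
    rw [diagonal_entry hk hαβk hi 0 (ne_of_gt (by push_cast; linarith))]
    simp [b1]
  · have key := diagonal_rational_identity_corner (k := k) (i := i)
      (q := α + β - k + 2 * i) β
      (ne_of_gt (by linarith)) (ne_of_gt (by linarith))
      (ne_of_gt (by linarith)) (ne_of_gt (by linarith)) (ne_of_gt (by linarith))
      (ne_of_gt (by linarith)) (ne_of_gt (by linarith)) (ne_of_gt (by linarith))
    have h0 : a2 (i + 1) α β k i 0 = 0 := by simp [a2]
    rw [b2_mul_a2_pred, Nat.succ_eq_add_one, h0, zero_mul, add_zero]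
    simp only [a1, a3, b1, b3]
    push_cast
    refine Eq.trans ?_ (key.trans ?_) <;>
      refine congrArg₂ (· + ·) ?_ ?_ <;> apply div_mul_div_congr <;> ring

end DiagonalEntries

/-- The LU block factorization identities for the Jacobi-type example, with
the parameter `α` shifted by one in the factors. -/
theorem stmt_9 (d : ℕ) (hd : 1 ≤ d) (α β k : ℝ)
    (hk : 0 < k) (hkβ : k < β + 1) (hαβk : 0 < α + β - k) :
    (∀ n : ℕ, Am d α β k n = Sm d (α + 1) β k n * Xm d (α + 1) β k n) ∧
    (Bm d α β k 0 = Sm d (α + 1) β k 0 * Ym d (α + 1) β k 0) ∧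
    (∀ n : ℕ, 1 ≤ n → Bm d α β k n =
      Rm d (α + 1) β k n * Xm d (α + 1) β k (n - 1) +
        Sm d (α + 1) β k n * Ym d (α + 1) β k n) ∧
    (∀ n : ℕ, 1 ≤ n → Cm d α β k n =
      Rm d (α + 1) β k n * Ym d (α + 1) β k (n - 1)) := by
  refine ⟨fun n => ?_, ?_, fun n hn => ?_, fun n hn => ?_⟩
  · ext ⟨i, hi⟩ ⟨j, hj⟩
    rw [Sm_mul_Xm_apply]
    simp only [Am, Matrix.of_apply]
    by_cases hij : i = j
    · subst hij
      rcases i with _ | i <;> simp [a1_mul_b3, b2_zero]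
    · by_cases hji : i = j + 1
      · subst hji
        simp [a1_mul_b2_succ]
      · rcases i with _ | i
        · simp [hij, b2_zero]
        · have h : i ≠ j := fun h => hji (by rw [h])
          simp [hij, h]
  · ext i j
    rw [Sm_mul_Ym_apply]
    have h := (diagonal_entry_zero hk hαβk i.isLt).trans (zero_add _).symm
    rw [Bm_apply_of_diagonal α β k 0 i j 0 h, ite_self, zero_add]
  · obtain ⟨n, rfl⟩ := Nat.exists_eq_add_of_le' hn
    ext i j
    rw [Matrix.add_apply, Rm_mul_apply, Sm_mul_Ym_apply, Nat.add_sub_cancel,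
      Bm_apply_of_diagonal α β k (n + 1) i j _ (diagonal_entry_succ hk hαβk i.isLt n)]
    simp [Xm]
  · obtain ⟨n, rfl⟩ := Nat.exists_eq_add_of_le' hn
    ext ⟨i, hi⟩ ⟨j, hj⟩
    rw [Rm_mul_apply]
    simp only [Cm, Ym, Matrix.of_apply, Nat.add_sub_cancel, a3_mul_b1, a2_mul_b1_succ, mul_ite,
      mul_zero]
end

section
/- Let α, β, k be real numbers with α > 0, β > −1 and 0 < k < β + 1, and let s₁₁, s₁₂ be real numbers. Define α₀ = [[ ((β−k+1)/((1+α+β−k)(1+k)(2+α+β−k)) + α(2+α+β−k)/((2+α+β)(1+α+β−k)))·s₁₁, ((β−k+1)/((1+k)(2+α+β−k)))·s₁₂ ], [ (1+α)/((3+α+β)(2+α+β−k)), (1+α)(1+α+β−k)/((3+α+β)(2+α+β−k)) ]], and assume det α₀ ≠ 0. Then α₀^{−1}μ₀ − μ₋₁ = τ₀ · N · μ₀^{(α−1)} · τ₀ᵀ, where N = [[ α(α+1)/((α+β+2)(α+β+3)·det α₀) − 1, (β−k+1)(α+1)(1−s₁₂)/((det α₀)(k+1)(α+β+3)(α+β−k+2))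 ], [ 0, 0 ]], μ₀^{(α−1)} is μ₀ with α replaced by α − 1, and τ₀ is the inverse of the matrix τ₀^{−1} = [[1, 0], [1/(α+β−k+2), (α+β−k+1)/(α+β−k+2)]]. -/
open Matrix

/-- The zeroth moment `μ₀` of the weight `W` of the `d = 2` Jacobi-type
example. -/
noncomputable def mu0 (α β k : ℝ) : Matrix (Fin 2) (Fin 2) ℝ :=
  (Real.Gamma (α + 1) * Real.Gamma (β + 2) * (α + β - k + 2) /
      Real.Gamma (α + β + 3)) •
    !![1, 0; 0, (α + 1) * (k + 1) / ((α + β + 3) * (β - k + 1))]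

/-- The `(-1)`-st moment `μ₋₁` of the weight `W` of the `d = 2` Jacobi-type
example. -/
noncomputable def muM1 (α β k : ℝ) : Matrix (Fin 2) (Fin 2) ℝ :=
  (Real.Gamma α * Real.Gamma (β + 2) / Real.Gamma (α + β + 2)) •
    !![α + β - k + 1, -1;
       -1, ((α + 1) * (k + 1) * (α + β - k + 2) - k * (β - k + 1)) /
         ((α + β + 2) * (β - k + 1))]

/-- The matrix `τ₀⁻¹` of the `d = 2` Jacobi-type example. -/
noncomputable def tau0inv (α β k : ℝ) : Matrix (Fin 2) (Fin 2) ℝ :=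
  !![1, 0; 1 / (α + β - k + 2), (α + β - k + 1) / (α + β - k + 2)]

/-- Explicit inverse of `tau0inv`. -/
lemma tau0inv_inv {α β k : ℝ} (h₁ : α + β - k + 1 ≠ 0) (h₂ : α + β - k + 2 ≠ 0) :
    (tau0inv α β k)⁻¹ =
      !![1, 0; -1 / (α + β - k + 1), (α + β - k + 2) / (α + β - k + 1)] := by
  apply Matrix.inv_eq_left_inv
  ext i j
  fin_cases i <;> fin_cases j <;> simp [tau0inv, Matrix.mul_apply, Fin.sum_univ_two] <;>
    field_simp
  ring

/-- `mu0` after extracting the scalar factor common with `muM1`. -/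
lemma mu0_eq {α β k : ℝ} (hα : α ≠ 0) (h : α + β + 2 ≠ 0) :
    mu0 α β k = (Real.Gamma α * Real.Gamma (β + 2) / Real.Gamma (α + β + 2)) •
      (α * (α + β - k + 2) / (α + β + 2)) •
      !![1, 0; 0, (α + 1) * (k + 1) / ((α + β + 3) * (β - k + 1))] := by
  rw [mu0, smul_smul, Real.Gamma_add_one hα,
    show α + β + 3 = α + β + 2 + 1 by ring, Real.Gamma_add_one h]
  congr 1
  rw [div_mul_div_comm]
  congr 1 <;> ring

/-- `mu0` at `α - 1` after extracting the scalar factor common with `muM1`. -/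
lemma mu0_sub_one (α β k : ℝ) :
    mu0 (α - 1) β k = (Real.Gamma α * Real.Gamma (β + 2) / Real.Gamma (α + β + 2)) •
      (α + β - k + 1) •
      !![1, 0; 0, α * (k + 1) / ((α + β + 2) * (β - k + 1))] := by
  rw [mu0, smul_smul, show α - 1 + 1 = α by ring, show α - 1 + β + 3 = α + β + 2 by ring,
    show α - 1 + β - k + 2 = α + β - k + 1 by ring]
  congr 1
  ring

/-- In case (a) (`X n` diagonal), the Dirac mass `M = α₀⁻¹μ₀ − μ₋₁` factors as
`τ₀ N μ₀|_{α→α-1} τ₀ᵀ` with `N` singular and upper triangular. -/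
theorem stmt_19 (α β k s11 s12 : ℝ) (hα : 0 < α) (hβ : β > -1)
    (hk : 0 < k) (hkβ : k < β + 1)
    (hdet : (!![((β - k + 1) / ((1 + α + β - k) * (1 + k) * (2 + α + β - k)) +
          α * (2 + α + β - k) / ((2 + α + β) * (1 + α + β - k))) * s11,
        (β - k + 1) / ((1 + k) * (2 + α + β - k)) * s12;
        (1 + α) / ((3 + α + β) * (2 + α + β - k)),
        (1 + α) * (1 + α + β - k) / ((3 + α + β) * (2 + α + β - k))] :
      Matrix (Fin 2) (Fin 2) ℝ).det ≠ 0) :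
    (!![((β - k + 1) / ((1 + α + β - k) * (1 + k) * (2 + α + β - k)) +
          α * (2 + α + β - k) / ((2 + α + β) * (1 + α + β - k))) * s11,
        (β - k + 1) / ((1 + k) * (2 + α + β - k)) * s12;
        (1 + α) / ((3 + α + β) * (2 + α + β - k)),
        (1 + α) * (1 + α + β - k) / ((3 + α + β) * (2 + α + β - k))] :
      Matrix (Fin 2) (Fin 2) ℝ)⁻¹ * mu0 α β k - muM1 α β k =
    (tau0inv α β k)⁻¹ *
      !![α * (α + 1) / ((α + β + 2) * (α + β + 3) *
           (!![((β - k + 1) / ((1 + α + β - k) * (1 + k) * (2 + α + β - k)) +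
                 α * (2 + α + β - k) / ((2 + α + β) * (1 + α + β - k))) * s11,
               (β - k + 1) / ((1 + k) * (2 + α + β - k)) * s12;
               (1 + α) / ((3 + α + β) * (2 + α + β - k)),
               (1 + α) * (1 + α + β - k) / ((3 + α + β) * (2 + α + β - k))] :
             Matrix (Fin 2) (Fin 2) ℝ).det) - 1,
         (β - k + 1) * (α + 1) * (1 - s12) /
           ((!![((β - k + 1) / ((1 + α + β - k) * (1 + k) * (2 + α + β - k)) +
                 α * (2 + α + β - k) / ((2 + α + β) * (1 + α + β - k))) * s11,
               (β - k + 1) / ((1 + k) * (2 + α + β - k)) * s12;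
               (1 + α) / ((3 + α + β) * (2 + α + β - k)),
               (1 + α) * (1 + α + β - k) / ((3 + α + β) * (2 + α + β - k))] :
             Matrix (Fin 2) (Fin 2) ℝ).det * (k + 1) * (α + β + 3) *
             (α + β - k + 2));
         0, 0] *
      mu0 (α - 1) β k * ((tau0inv α β k)⁻¹)ᵀ := by
  have h₁ : α + β - k + 1 ≠ 0 := by linarith
  have h₂ : α + β - k + 2 ≠ 0 := by linarith
  have h₃ : α + β + 2 ≠ 0 := by linarith
  have h₄ : α + β + 3 ≠ 0 := by linarith
  have h₅ : β - k + 1 ≠ 0 := by linarith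
  have h₆ : k + 1 ≠ 0 := by linarith
  have h₇ : α + 1 ≠ 0 := by linarith
  rw [tau0inv_inv h₁ h₂, mu0_eq hα.ne' h₃, mu0_sub_one, muM1, Matrix.inv_def,
    Matrix.adjugate_fin_two_of, Ring.inverse_eq_inv']
  simp only [Matrix.mul_smul, Matrix.smul_mul, ← smul_sub]
  congr 1
  rw [Matrix.det_fin_two_of] at hdet ⊢
  rw [show 1 + α + β - k = α + β - k + 1 by ring, show 2 + α + β - k = α + β - k + 2 by ring,
    show 3 + α + β = α + β + 3 by ring, show 2 + α + β = α + β + 2 by ring,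
    add_comm 1 k, add_comm 1 α] at hdet ⊢
  generalize hp : ((β - k + 1) / ((α + β - k + 1) * (k + 1) * (α + β - k + 2)) +
    α * (α + β - k + 2) / ((α + β + 2) * (α + β - k + 1))) * s11 = p at hdet ⊢
  generalize hD : p * ((α + 1) * (α + β - k + 1) / ((α + β + 3) * (α + β - k + 2))) -
    (β - k + 1) / ((k + 1) * (α + β - k + 2)) * s12 *
      ((α + 1) / ((α + β + 3) * (α + β - k + 2))) = D at hdet ⊢
  have hpD : p = (D + (β - k + 1) / ((k + 1) * (α + β - k + 2)) * s12 *
      ((α + 1) / ((α + β + 3) * (α + β - k + 2)))) /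
      ((α + 1) * (α + β - k + 1) / ((α + β + 3) * (α + β - k + 2))) := by
    rw [← hD, sub_add_cancel, mul_div_cancel_right₀]
    positivity
  rw [hpD]
  ext i j
  fin_cases i <;> fin_cases j <;>
    simp [Fin.sum_univ_two, Matrix.vecMul, dotProduct] <;>
    field_simp <;> ring
end
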